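/- arXiv:2604.04672 — 3 statements merged into one kernel-verified Lean document; each statement's English description precedes it below -/
import Mathlib

section
/- Let J and J' be Jordan curves in the plane. If J is contained in the closure of Ext J' and J' is not contained in the closure of Int J, then Int J is contained in Ext J'. -/
abbrev Plane := ℝ × ℝ

def IsJordanCurve (J : Set Plane) : Prop := Nonempty (Circle ≃ₜ J)

def intRegion (J : Set Plane) : Set Plane :=
  {z | z ∉ J ∧ Bornology.IsBounded (connectedComponentIn Jᶜ z)}

def extRegion (J : Set Plane) : Set Plane :=
  {z | z ∉ J ∧ ¬ Bornology.IsBounded (connectedComponentIn Jᶜ z)}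

open Set Topology unitInterval

/-! ### Continuous logarithms -/

/-- A map to `ℂ \ {0}` homotopic to the constant `1` has a continuous logarithm. -/
lemma exists_log_of_homotopy {A : Type*} [TopologicalSpace A] {H : I × A → ℂ}
    (hc : Continuous H) (hne : ∀ x, H x ≠ 0) (h0 : ∀ a, H (0, a) = 1) :
    ∃ g : C(A, ℂ), ∀ a, Complex.exp (g a) = H (1, a) := by
  let H' : C(I × A, {z : ℂ // z ≠ 0}) := ⟨fun x => ⟨H x, hne x⟩, hc.subtype_mk _⟩
  have h0' : ∀ a, H' (0, a) = (fun z : ℂ => (⟨_, z.exp_ne_zero⟩ : {z : ℂ // z ≠ 0}))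
      ((ContinuousMap.const A (0 : ℂ)) a) := fun a => Subtype.ext (by simp [H', h0])
  let G := Complex.isCoveringMap_exp.liftHomotopy H' (.const A 0) h0'
  refine ⟨G.comp ⟨fun a => (1, a), by fun_prop⟩, fun a => ?_⟩
  exact congrArg Subtype.val
    (congrFun (Complex.isCoveringMap_exp.liftHomotopy_lifts H' (.const A 0) h0') (1, a))

/-- Two continuous logarithms of the same function on a preconnected set differ by a constant. -/
lemma IsPreconnected.sub_eq_sub_of_exp_eq {X : Type*} [TopologicalSpace X] {s : Set X}
    (hs : IsPreconnected s) {f g : X → ℂ} (hf : ContinuousOn f s) (hg : ContinuousOn g s)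
    (h : ∀ x ∈ s, Complex.exp (f x) = Complex.exp (g x)) {x y : X} (hx : x ∈ s) (hy : y ∈ s) :
    f x - g x = f y - g y := by
  refine Complex.isCoveringMap_exp.eqOn_of_comp_eqOn hs (hf.sub hg)
    (continuousOn_const (c := f y - g y)) (fun z hz => Subtype.ext ?_) hy rfl hx
  simp [Complex.exp_sub, h z hz, h y hy]

/-- There is no continuous branch of `log (z - c)` on a circle centred at `c`. -/
lemma not_exists_log_sub_on_sphere {c : ℂ} {r : ℝ} (hr : 0 < r) {g : ℂ → ℂ}
    (hg : ContinuousOn g (Metric.sphere c r))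
    (h : ∀ z ∈ Metric.sphere c r, Complex.exp (g z) = z - c) : False := by
  have hmem : ∀ θ : ℝ, circleMap c r θ ∈ Metric.sphere c r :=
    fun θ => circleMap_mem_sphere c hr.le θ
  have key := isPreconnected_univ.sub_eq_sub_of_exp_eq (X := ℝ)
    (f := fun θ => g (circleMap c r θ)) (g := fun θ => Complex.log r + θ * Complex.I)
    (hg.comp (by fun_prop) fun θ _ => hmem θ) (by fun_prop)
    (fun θ _ => by
      rw [h _ (hmem θ), Complex.exp_add, Complex.exp_log (by exact_mod_cast hr.ne')]
      simp [circleMap]) (mem_univ 0) (mem_univ (2 * Real.pi))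
  have hper : circleMap c r (2 * Real.pi) = circleMap c r 0 := by
    simpa using periodic_circleMap c r 0
  simp [hper, Real.pi_ne_zero] at key

/-- If `γ` is a path then `(z - γ 0) / (z - γ 1)` has a continuous logarithm off `γ`. -/
lemma exists_log_div_compl_range {γ : I → ℂ} (hγ : Continuous γ) :
    ∃ L : ℂ → ℂ, ContinuousOn L (range γ)ᶜ ∧
      ∀ z ∉ range γ, Complex.exp (L z) = (z - γ 0) / (z - γ 1) := by
  have hne : ∀ (z : ((range γ)ᶜ : Set ℂ)) (t : I), (z : ℂ) - γ t ≠ 0 :=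
    fun z t h => z.2 ⟨t, (sub_eq_zero.1 h).symm⟩
  obtain ⟨g, hg⟩ := exists_log_of_homotopy (A := ((range γ)ᶜ : Set ℂ))
    (H := fun x => ((x.2 : ℂ) - γ 0) / ((x.2 : ℂ) - γ x.1))
    (Continuous.div (by fun_prop) (by fun_prop) fun x => hne x.2 x.1)
    (fun x => div_ne_zero (hne _ _) (hne _ _)) (fun a => div_self (hne _ _))
  classical
  refine ⟨fun z => if hz : z ∈ (range γ)ᶜ then g ⟨z, hz⟩ else 0, ?_, fun z hz => ?_⟩
  · rw [continuousOn_iff_continuous_domRestrict]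
    convert! g.continuous using 1
    ext z
    exact dif_pos z.2
  · simpa [show z ∈ (range γ)ᶜ from hz] using! hg ⟨z, hz⟩

/-- There is no continuous branch of `log ((z - a) / (z - b))` on `ℂ \ {a, b}`. -/
lemma not_exists_log_div {a b : ℂ} (hab : a ≠ b) {L : ℂ → ℂ} (hL : ContinuousOn L {a, b}ᶜ)
    (h : ∀ z ∉ ({a, b} : Set ℂ), Complex.exp (L z) = (z - a) / (z - b)) : False := by
  have hd : 0 < ‖a - b‖ := norm_pos_iff.2 (sub_ne_zero.2 hab)
  have hab' := sub_ne_zero.2 hab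
  have hnorm : ∀ z ∈ Metric.sphere a (‖a - b‖ / 2), ‖z - a‖ = ‖a - b‖ / 2 := fun z hz => by
    simpa [dist_eq_norm] using hz
  have hsub : ∀ z ∈ Metric.sphere a (‖a - b‖ / 2), z ∈ ({a, b} : Set ℂ)ᶜ := by
    rintro z hz (rfl | rfl)
    · have := hnorm z hz; rw [sub_self, norm_zero] at this; linarith
    · have := hnorm z hz; rw [norm_sub_rev] at this; linarith
  have hslit : ∀ z ∈ Metric.sphere a (‖a - b‖ / 2), (z - b) / (a - b) ∈ Complex.slitPlane := by
    intro z hz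
    have : (z - b) / (a - b) = 1 + (z - a) / (a - b) := by field_simp; ring
    rw [this]
    apply Complex.mem_slitPlane_of_norm_lt_one
    rw [norm_div, hnorm z hz, div_div, div_lt_one (by positivity)]
    linarith
  refine not_exists_log_sub_on_sphere (c := a) (r := ‖a - b‖ / 2) (by positivity)
    (g := fun z => L z + Complex.log ((z - b) / (a - b)) + Complex.log (a - b)) ?_ ?_
  · exact ((hL.mono hsub).add
      (ContinuousOn.clog (by fun_prop) hslit)).add continuousOn_const
  · intro z hz
    have hzb : z - b ≠ 0 := fun h0 => hsub z hz (by simp [sub_eq_zero.1 h0])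
    rw [Complex.exp_add, Complex.exp_add, h z (hsub z hz),
      Complex.exp_log (Complex.slitPlane_ne_zero (hslit z hz)), Complex.exp_log hab']
    field_simp

/-! ### Jordan curves in the complex plane -/

/-- Two paths in the plane with the same endpoints that meet only there separate the plane. -/
lemma not_isPreconnected_compl_union_range {γ δ : I → ℂ} (hγ : Continuous γ) (hδ : Continuous δ)
    (h0 : γ 0 = δ 0) (h1 : γ 1 = δ 1) (hne : γ 0 ≠ γ 1)
    (hinter : range γ ∩ range δ ⊆ {γ 0, γ 1}) : ¬ IsPreconnected (range γ ∪ range δ)ᶜ := by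
  intro hpre
  obtain ⟨L, hLc, hL⟩ := exists_log_div_compl_range hγ
  obtain ⟨M, hMc, hM⟩ := exists_log_div_compl_range hδ
  rw [← h0, ← h1] at hM
  have hγo : IsOpen (range γ)ᶜ := (isCompact_range hγ).isClosed.isOpen_compl
  have hδo : IsOpen (range δ)ᶜ := (isCompact_range hδ).isClosed.isOpen_compl
  obtain ⟨k, hk⟩ : ∃ k : ℂ, Complex.exp k = 1 ∧
      ∀ z ∈ (range γ ∪ range δ)ᶜ, L z = M z + k := by
    by_cases hemp : ((range γ ∪ range δ)ᶜ).Nonempty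
    · obtain ⟨w, hw⟩ := hemp
      have hexp : ∀ z ∈ (range γ ∪ range δ)ᶜ, Complex.exp (L z) = Complex.exp (M z) :=
        fun z hz => by rw [hL z fun h => hz (.inl h), hM z fun h => hz (.inr h)]
      refine ⟨L w - M w, by simp [Complex.exp_sub, hexp w hw], fun z hz => ?_⟩
      rw [← hpre.sub_eq_sub_of_exp_eq
        (hLc.mono (compl_subset_compl.2 subset_union_left))
        (hMc.mono (compl_subset_compl.2 subset_union_right)) hexp hz hw]
      ring
    · exact ⟨0, by simp, fun z hz => (hemp ⟨z, hz⟩).elim⟩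
  classical
  let N : ℂ → ℂ := fun z => if z ∈ range γ then M z + k else L z
  have hNL : ∀ z ∈ (range γ)ᶜ, N z = L z := fun z hz => if_neg hz
  have hNM : ∀ z ∈ (range δ)ᶜ, N z = M z + k := fun z hz => by
    by_cases hzγ : z ∈ range γ
    · exact if_pos hzγ
    · rw [hNL z hzγ, hk.2 z (by simp_all)]
  have hcover : ∀ z ∉ ({γ 0, γ 1} : Set ℂ), z ∈ (range γ)ᶜ ∨ z ∈ (range δ)ᶜ := fun z hz => by
    by_contra! hcon
    exact hz (hinter ⟨not_not.1 hcon.1, not_not.1 hcon.2⟩)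
  refine not_exists_log_div hne (L := N) (fun z hz => ?_) (fun z hz => ?_)
  · refine ContinuousAt.continuousWithinAt ?_
    rcases hcover z hz with hz | hz
    · exact (hLc.continuousAt (hγo.mem_nhds hz)).congr
        (Filter.eventuallyEq_of_mem (hγo.mem_nhds hz) fun y hy => (hNL y hy).symm)
    · exact ((hMc.continuousAt (hδo.mem_nhds hz)).add continuousAt_const).congr
        (Filter.eventuallyEq_of_mem (hδo.mem_nhds hz) fun y hy => (hNM y hy).symm)
  · rcases hcover z hz with hz | hz
    · rw [hNL z hz, hL z hz]
    · rw [hNM z hz, Complex.exp_add, hk.1, mul_one, hM z hz]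

/-- A Jordan curve separates the plane. -/
lemma not_isPreconnected_compl_of_circle {J : Set ℂ} (e : Circle ≃ₜ J) :
    ¬ IsPreconnected Jᶜ := by
  have hJ : J = range (fun t : I => (e (Circle.exp (Real.pi * t)) : ℂ)) ∪
      range (fun t : I => (e (Circle.exp (-(Real.pi * t))) : ℂ)) := by
    apply Subset.antisymm
    · intro z hz
      obtain ⟨c, hc⟩ := e.surjective ⟨z, hz⟩
      have hpi := Real.pi_pos
      have hle := abs_le.1 (Complex.abs_arg_le_pi (c : ℂ))
      rcases le_total 0 (Complex.arg c) with h | h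
      · refine .inl ⟨⟨Complex.arg c / Real.pi, by positivity,
          (div_le_one hpi).2 hle.2⟩, ?_⟩
        simp [mul_div_cancel₀ _ hpi.ne', hc]
      · refine .inr ⟨⟨-Complex.arg c / Real.pi, div_nonneg (by linarith) hpi.le,
          (div_le_one hpi).2 (by linarith)⟩, ?_⟩
        simp [mul_div_cancel₀ _ hpi.ne', hc]
    · rintro z (⟨t, rfl⟩ | ⟨t, rfl⟩) <;> exact Subtype.coe_prop _
  have hinj : ∀ {x y : ℝ}, (e (Circle.exp x) : ℂ) = e (Circle.exp y) →
      ∃ m : ℤ, x = y + m * (2 * Real.pi) := fun h =>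
    Circle.exp_eq_exp.1 (e.injective (Subtype.ext h))
  rw [hJ]
  refine not_isPreconnected_compl_union_range (by fun_prop) (by fun_prop) (by simp) ?_ ?_ ?_
  · simp only [Icc.coe_one, mul_one]
    rw [show Circle.exp Real.pi = Circle.exp (-Real.pi) from
      Circle.exp_eq_exp.2 ⟨1, by push_cast; ring⟩]
  · intro h
    obtain ⟨m, hm⟩ := hinj h
    have hpi := Real.pi_pos
    have : (0 : ℝ) = 1 + 2 * m := by
      apply mul_left_cancel₀ hpi.ne'
      simp at hm
      linarith
    have : (0 : ℤ) = 1 + 2 * m := by exact_mod_cast this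
    omega
  · rintro z ⟨⟨s, rfl⟩, ⟨t, ht⟩⟩
    obtain ⟨m, hm⟩ := hinj ht
    have hsum : -(t : ℝ) - s = 2 * m := by
      apply mul_left_cancel₀ Real.pi_ne_zero
      linarith
    obtain ⟨hs0, hs1⟩ := s.2
    obtain ⟨ht0, ht1⟩ := t.2
    have hm0 : m ≤ 0 := by
      have : (m : ℝ) ≤ 0 := by linarith
      exact_mod_cast this
    have hm1 : -1 ≤ m := by
      have : (-1 : ℝ) ≤ m := by linarith
      exact_mod_cast this
    obtain rfl | rfl : m = 0 ∨ m = -1 := by omega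
    · left
      have : s = 0 := Subtype.ext (by push_cast at hsum ⊢; linarith)
      simp [this]
    · right
      have : s = 1 := Subtype.ext (by push_cast at hsum ⊢; linarith)
      simp [this]

/-- The exterior of a closed disc is preconnected. -/
lemma isPreconnected_setOf_lt_norm {R : ℝ} (hR : 0 ≤ R) : IsPreconnected {z : ℂ | R < ‖z‖} := by
  have : {z : ℂ | R < ‖z‖} =
      (fun p : ℝ × ℝ => (p.1 : ℂ) * Complex.exp (p.2 * Complex.I)) '' (Ioi R ×ˢ univ) := by
    ext z
    constructor
    · intro hz
      exact ⟨(‖z‖, Complex.arg z), ⟨hz, mem_univ _⟩, Complex.norm_mul_exp_arg_mul_I z⟩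
    · rintro ⟨⟨r, θ⟩, ⟨hr, -⟩, rfl⟩
      have hr' : R < r := hr
      simpa [Complex.norm_exp_ofReal_mul_I, abs_of_pos (hR.trans_lt hr')] using hr'
  rw [this]
  exact (isPreconnected_Ioi.prod isPreconnected_univ).image _ (by fun_prop)

/-- If the complement of a bounded set is disconnected then it has a bounded component. -/
lemma exists_isBounded_connectedComponentIn_compl {K : Set ℂ} (hK : Bornology.IsBounded K)
    (h : ¬ IsPreconnected Kᶜ) :
    ∃ z ∉ K, Bornology.IsBounded (connectedComponentIn Kᶜ z) := by
  by_contra! hcon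
  obtain ⟨R, hR⟩ := hK.subset_closedBall (0 : ℂ)
  have hE : {z : ℂ | max R 0 < ‖z‖} ⊆ Kᶜ := fun z hz hzK => by
    have h1 : ‖z‖ ≤ R := by simpa using hR hzK
    exact absurd (lt_of_le_of_lt (le_max_left R 0) hz) h1.not_gt
  have hpre := isPreconnected_setOf_lt_norm (le_max_right R 0)
  have hw : ((max R 0 + 1 : ℝ) : ℂ) ∈ {z : ℂ | max R 0 < ‖z‖} := by
    have : 0 ≤ max R 0 := le_max_right R 0
    rw [mem_ofPred_eq, Complex.norm_real, Real.norm_of_nonneg (by linarith)]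
    linarith
  set w : ℂ := ((max R 0 + 1 : ℝ) : ℂ)
  apply h
  convert! isPreconnected_connectedComponentIn (x := w) (F := Kᶜ)
  refine Subset.antisymm (fun z hz => ?_) (connectedComponentIn_subset _ _)
  obtain ⟨v, hv, hvR⟩ : ∃ v ∈ connectedComponentIn Kᶜ z, max R 0 < ‖v‖ := by
    by_contra! hle
    exact hcon z hz ((Metric.isBounded_closedBall (x := (0 : ℂ)) (r := max R 0)).subset
      fun v hv => by simpa using hle v hv)
  have hvw : v ∈ connectedComponentIn Kᶜ w := hpre.subset_connectedComponentIn hw hE hvR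
  rw [connectedComponentIn_eq hvw, ← connectedComponentIn_eq hv]
  exact mem_connectedComponentIn hz

/-- On the frontier of a bounded set containing `z₀` there is no continuous branch of
`log (z - z₀)`. -/
lemma not_exists_log_sub_on_frontier {U : Set ℂ} (hb : Bornology.IsBounded U)
    {z₀ : ℂ} (hz₀ : z₀ ∈ U) (g : C(frontier U, ℂ))
    (hg : ∀ x, Complex.exp (g x) = x - z₀) : False := by
  obtain ⟨G, hG⟩ := g.exists_restrict_eq isClosed_frontier
  have hG' : ∀ x (hx : x ∈ frontier U), Complex.exp (G x) = x - z₀ := fun x hx => by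
    rw [← hg ⟨x, hx⟩, ← hG]; rfl
  classical
  let h : ℂ → ℂ := fun z => if z ∈ U then Complex.exp (G z) else z - z₀
  have hc : Continuous h := Continuous.if hG' (by fun_prop) (by fun_prop)
  have hne : ∀ z, h z ≠ 0 := fun z => by
    by_cases hz : z ∈ U
    · simp [h, hz]
    · simpa [h, hz, sub_eq_zero] using fun h0 : z = z₀ => hz (h0 ▸ hz₀)
  obtain ⟨L, hL⟩ := exists_log_of_homotopy (A := ℂ)
    (H := fun x => h (((x.1 : ℝ) : ℂ) * x.2) / h 0)
    ((hc.comp (by fun_prop)).div_const _) (fun x => div_ne_zero (hne _) (hne _))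
    (fun a => by simp [hne])
  obtain ⟨R, hR⟩ := hb.subset_closedBall z₀
  have hR0 : 0 ≤ R := by simpa using dist_nonneg.trans (hR hz₀)
  refine not_exists_log_sub_on_sphere (c := z₀) (r := R + 1) (by linarith)
    (g := fun z => L z + Complex.log (h 0)) (by fun_prop) fun z hz => ?_
  have hzU : z ∉ U := fun hzU => by
    have h1 := hR hzU
    rw [Metric.mem_closedBall] at h1
    rw [Metric.mem_sphere] at hz
    linarith
  rw [Complex.exp_add, hL, Complex.exp_log (hne 0), div_mul_cancel₀ _ (hne 0)]
  simp [h, hzU]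

/-- On a proper subset of a Jordan curve, `z - z₀` has a continuous logarithm. -/
lemma exists_log_sub_on_ssubset {J : Set ℂ} (e : Circle ≃ₜ J) {K : Set ℂ} (hKJ : K ⊆ J)
    {p : ℂ} (hp : p ∈ J) (hpK : p ∉ K) {z₀ : ℂ} (hz₀ : z₀ ∉ J) :
    ∃ g : C(K, ℂ), ∀ x, Complex.exp (g x) = x - z₀ := by
  let c : Circle := Circle.exp Real.pi * e.symm ⟨p, hp⟩
  let ψ : K → Circle := fun x => e.symm ⟨x, hKJ x.2⟩ / c
  have hψ : Continuous ψ := by fun_prop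
  have harg : ∀ x, (ψ x : ℂ) ∈ Complex.slitPlane := fun x => by
    refine Complex.mem_slitPlane_iff_arg.2 ⟨fun h => hpK ?_, Circle.coe_ne_zero _⟩
    have h1 : ψ x = Circle.exp Real.pi := by rw [← h, Circle.exp_arg]
    have h2 : e.symm ⟨x, hKJ x.2⟩ = e.symm ⟨p, hp⟩ := by
      rw [div_eq_iff_eq_mul.1 h1, ← mul_assoc, ← Circle.exp_add, ← two_mul, Circle.exp_two_pi,
        one_mul]
    have h3 : (x : ℂ) = p := congrArg Subtype.val (e.symm.injective h2)
    exact h3 ▸ x.2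
  have hargc : Continuous fun x => Complex.arg (ψ x) :=
    continuous_iff_continuousAt.2 fun x =>
      ContinuousAt.comp (f := fun x => (ψ x : ℂ)) (Complex.continuousAt_arg (harg x))
        (by fun_prop)
  have hne : ∀ d : Circle, (e d : ℂ) - z₀ ≠ 0 := fun d h => hz₀ (sub_eq_zero.1 h ▸ (e d).2)
  obtain ⟨g, hg⟩ := exists_log_of_homotopy (A := K)
    (H := fun x => ((e (Circle.exp (x.1 * Complex.arg (ψ x.2)) * c) : ℂ) - z₀) / (e c - z₀))
    (((continuous_subtype_val.comp (e.continuous.comp ((Circle.exp.continuous.comp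
      ((continuous_subtype_val.comp continuous_fst).mul (hargc.comp continuous_snd))).mul
      continuous_const))).sub continuous_const).div_const _)
    (fun x => div_ne_zero (hne _) (hne _)) (fun a => by simp [hne])
  refine ⟨g + .const K (Complex.log (e c - z₀)), fun x => ?_⟩
  rw [ContinuousMap.add_apply, ContinuousMap.const_apply, Complex.exp_add, hg,
    Complex.exp_log (hne c), div_mul_cancel₀ _ (hne c)]
  rw [Icc.coe_one, one_mul, Circle.exp_arg, div_mul_cancel, e.apply_symm_apply]

/-- The boundary of a nonempty bounded set off a Jordan curve cannot be a proper
subset of the curve. -/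
lemma subset_frontier_of_circle {J U : Set ℂ} (e : Circle ≃ₜ J)
    (hb : Bornology.IsBounded U) (hne : U.Nonempty) (hdisj : Disjoint U J)
    (hfr : frontier U ⊆ J) : J ⊆ frontier U := by
  intro p hp
  by_contra hpU
  obtain ⟨z₀, hz₀⟩ := hne
  obtain ⟨g, hg⟩ := exists_log_sub_on_ssubset e hfr hp hpU (disjoint_left.1 hdisj hz₀)
  exact not_exists_log_sub_on_frontier hb hz₀ g hg

/-- The frontier of a component of an open set lies outside that set. -/
lemma frontier_connectedComponentIn_subset_compl {X : Type*} [TopologicalSpace X]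
    [LocallyConnectedSpace X] {V : Set X} (hV : IsOpen V) (x : X) :
    frontier (connectedComponentIn V x) ⊆ Vᶜ := by
  intro y hy hyV
  rw [hV.connectedComponentIn.frontier_eq] at hy
  obtain ⟨w, hwy, hwx⟩ := mem_closure_iff.1 hy.1 _ (hV.connectedComponentIn (x := y))
    (mem_connectedComponentIn hyV)
  apply hy.2
  rw [connectedComponentIn_eq hwx, ← connectedComponentIn_eq hwy]
  exact mem_connectedComponentIn hyV

/-! ### Jordan curves in `ℝ × ℝ` -/

lemma connectedComponentIn_subset_intRegion {J : Set Plane} {z : Plane} (hz : z ∈ intRegion J) :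
    connectedComponentIn Jᶜ z ⊆ intRegion J := fun _ hw =>
  ⟨connectedComponentIn_subset _ _ hw, connectedComponentIn_eq hw ▸ hz.2⟩

lemma image_equivRealProd_connectedComponentIn {J : Set Plane} {z : Plane} (hz : z ∉ J) :
    Complex.equivRealProdCLM.symm '' connectedComponentIn Jᶜ z =
      connectedComponentIn (Complex.equivRealProdCLM.symm '' J)ᶜ
        (Complex.equivRealProdCLM.symm z) := by
  rw [← image_compl_eq Complex.equivRealProdCLM.symm.bijective]
  exact Complex.equivRealProdCLM.symm.toHomeomorph.image_connectedComponentIn hz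

namespace IsJordanCurve

variable {J : Set Plane}

lemma isCompact (hJ : IsJordanCurve J) : IsCompact J := by
  obtain ⟨e⟩ := hJ
  exact isCompact_iff_compactSpace.2 e.compactSpace

lemma exists_homeomorph_image (hJ : IsJordanCurve J) :
    Nonempty (Circle ≃ₜ (Complex.equivRealProdCLM.symm '' J : Set ℂ)) :=
  hJ.map fun e => e.trans (Complex.equivRealProdCLM.symm.toHomeomorph.image J)

lemma intRegion_nonempty (hJ : IsJordanCurve J) : (intRegion J).Nonempty := by
  obtain ⟨e⟩ := hJ.exists_homeomorph_image
  obtain ⟨w, hw, hb⟩ := exists_isBounded_connectedComponentIn_compl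
    (hJ.isCompact.image Complex.equivRealProdCLM.symm.continuous).isBounded
    (not_isPreconnected_compl_of_circle e)
  obtain ⟨z, rfl⟩ := Complex.equivRealProdCLM.symm.surjective w
  have hz : z ∉ J := fun h => hw (mem_image_of_mem _ h)
  refine ⟨z, hz, ?_⟩
  rw [← image_equivRealProd_connectedComponentIn hz] at hb
  exact Complex.equivRealProdCLM.symm.antilipschitz.isBounded_preimage hb |>.subset
    (subset_preimage_image _ _)

lemma subset_closure_connectedComponentIn (hJ : IsJordanCurve J) {z : Plane}
    (hz : z ∈ intRegion J) : J ⊆ closure (connectedComponentIn Jᶜ z) := by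
  obtain ⟨e⟩ := hJ.exists_homeomorph_image
  have hJc : IsOpen (Complex.equivRealProdCLM.symm '' J)ᶜ :=
    (hJ.isCompact.image Complex.equivRealProdCLM.symm.continuous).isClosed.isOpen_compl
  have himage := image_equivRealProd_connectedComponentIn hz.1
  have hsub := subset_frontier_of_circle e
    (U := connectedComponentIn (Complex.equivRealProdCLM.symm '' J)ᶜ
      (Complex.equivRealProdCLM.symm z))
    (himage ▸ Complex.equivRealProdCLM.symm.lipschitz.isBounded_image hz.2)
    (himage ▸ ⟨_, mem_image_of_mem _ (mem_connectedComponentIn hz.1)⟩)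
    (disjoint_left.2 fun _ h => connectedComponentIn_subset _ _ h)
    ((frontier_connectedComponentIn_subset_compl hJc _).trans_eq (compl_compl _))
  have hsub' := hsub.trans frontier_subset_closure
  rw [← himage] at hsub'
  have himcl := Complex.equivRealProdCLM.symm.toHomeomorph.image_closure
    (connectedComponentIn Jᶜ z)
  exact (image_subset_image_iff Complex.equivRealProdCLM.symm.injective).1
    (hsub'.trans himcl.ge)

lemma isOpen_intRegion (hJ : IsJordanCurve J) : IsOpen (intRegion J) := by
  have hJc : IsOpen Jᶜ := hJ.isCompact.isClosed.isOpen_compl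
  exact isOpen_iff_forall_mem_open.2 fun z hz => ⟨connectedComponentIn Jᶜ z,
    connectedComponentIn_subset_intRegion hz, hJc.connectedComponentIn,
    mem_connectedComponentIn hz.1⟩

end IsJordanCurve

theorem stmt1 (J J' : Set Plane) (hJ : IsJordanCurve J) (hJ' : IsJordanCurve J')
    (h1 : J ⊆ closure (extRegion J')) (h2 : ¬ J' ⊆ closure (intRegion J)) :
    intRegion J ⊆ extRegion J' := by
  have hJint : ∀ x ∈ intRegion J', x ∉ J := fun x hx hxJ => by
    obtain ⟨y, hy, hy'⟩ := mem_closure_iff.1 (h1 hxJ) _ hJ'.isOpen_intRegion hx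
    exact hy'.2 hy.2
  have hdisj : ∀ x ∈ intRegion J', x ∉ intRegion J := fun x hx hxJ => by
    have hsub : connectedComponentIn J'ᶜ x ⊆ connectedComponentIn Jᶜ x :=
      isPreconnected_connectedComponentIn.subset_connectedComponentIn
        (mem_connectedComponentIn hx.1)
        fun y hy => hJint y (connectedComponentIn_subset_intRegion hx hy)
    exact h2 ((hJ'.subset_closure_connectedComponentIn hx).trans
      (closure_mono (hsub.trans (connectedComponentIn_subset_intRegion hxJ))))
  obtain ⟨z, hz⟩ := hJ'.intRegion_nonempty
  intro x hx
  have hxJ' : x ∉ J' := fun hxJ' => by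
    obtain ⟨y, hy, hy'⟩ := mem_closure_iff.1
      (hJ'.subset_closure_connectedComponentIn hz hxJ') _ hJ.isOpen_intRegion hx
    exact hdisj y (connectedComponentIn_subset_intRegion hz hy') hy
  exact ⟨hxJ', fun hb => hdisj x ⟨hxJ', hb⟩ hx⟩
end

section
/- Let Γ be a set of topological lines in ℝ² such that γ \ γ' is a portion of γ for all distinct γ, γ' ∈ Γ, and for distinct γ, γ' let J(γ,γ') := cl(γ △ γ'), a Jordan curve. Then for all distinct γ, γ', σ ∈ Γ, either J(γ, σ) ⊂ cl(Int J(γ, γ')) or J(γ, σ) ⊂ cl(Ext J(γ, γ')). -/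
/-- A topological line: a subset of the plane homeomorphic to `ℝ`. -/
def IsTopLine (γ : Set Plane) : Prop := Nonempty (ℝ ≃ₜ γ)

/-- A portion of a topological line `γ` : a subset whose preimage under any
parametrizing homeomorphism `ℝ ≃ₜ γ` is a bounded open interval. -/
def IsPortion (γ π : Set Plane) : Prop :=
  π ⊆ γ ∧ ∀ Φ : ℝ ≃ₜ γ, ∃ a b : ℝ, {t : ℝ | (Φ t : Plane) ∈ π} = Set.Ioo a b

/-- The Jordan curve associated with two topological lines. -/
noncomputable def lineJ (γ γ' : Set Plane) : Set Plane := closure (symmDiff γ γ')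

open Set Topology

/-- Every continuous nonvanishing complex function on `A` has a continuous logarithm on `A`. -/
def HasLogs {X : Type*} [TopologicalSpace X] (A : Set X) : Prop :=
  ∀ f : X → ℂ, ContinuousOn f A → (∀ x ∈ A, f x ≠ 0) →
    ∃ L : X → ℂ, ContinuousOn L A ∧ ∀ x ∈ A, Complex.exp (L x) = f x

theorem hasLogs_univ_of_contractible {X : Type*} [TopologicalSpace X]
    [LocallyPathConnectedSpace X] [ContractibleSpace X] : HasLogs (univ : Set X) := by
  intro f hf h0
  obtain ⟨x₀⟩ : Nonempty X := inferInstance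
  obtain ⟨F, ⟨-, hF⟩, -⟩ := Complex.isCoveringMapOn_exp.existsUnique_continuousMap_lifts
    (⟨f, continuousOn_univ.1 hf⟩ : C(X, ℂ)) (a₀ := x₀) (Complex.exp_log (h0 x₀ trivial))
    (fun a => h0 a trivial)
  exact ⟨F, F.continuous.continuousOn, fun x _ => congrFun hF x⟩

theorem Topology.IsEmbedding.continuousOn_invFun {X Y : Type*} [TopologicalSpace X]
    [TopologicalSpace Y] [Nonempty X] {f : X → Y} (hf : IsEmbedding f) :
    ContinuousOn (Function.invFun f) (range f) := by
  rw [hf.continuousOn_iff]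
  exact continuousOn_id.congr fun y hy => Function.invFun_eq hy

theorem hasLogs_image_Icc {X : Type*} [TopologicalSpace X] {φ : ℝ → X} (hφ : IsEmbedding φ)
    {a b : ℝ} (hab : a ≤ b) : HasLogs (φ '' Icc a b) := by
  intro f hf h0
  have hc : Continuous (IccExtend hab ((Icc a b).domRestrict (f ∘ φ))) :=
    (continuousOn_iff_continuous_domRestrict.1
      (hf.comp hφ.continuous.continuousOn (mapsTo_image _ _))).Icc_extend'
  obtain ⟨l, hl, hexp⟩ := hasLogs_univ_of_contractible _ hc.continuousOn fun t _ =>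
    h0 _ (mem_image_of_mem φ (projIcc a b hab t).2)
  refine ⟨l ∘ Function.invFun φ, (continuousOn_univ.1 hl).comp_continuousOn
    (hφ.continuousOn_invFun.mono (image_subset_range _ _)), ?_⟩
  rintro _ ⟨t, ht, rfl⟩
  have := hexp t trivial
  rw [IccExtend_of_mem hab _ ht] at this
  simpa [Function.leftInverse_invFun hφ.injective t] using this

theorem HasLogs.union {X : Type*} [TopologicalSpace X] {A B : Set X} (hA : HasLogs A)
    (hB : HasLogs B) (hAc : IsClosed A) (hBc : IsClosed B) {x : X} (hxA : x ∈ A) (hxB : x ∈ B)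
    (hAB : ∀ y ∈ A, y ∈ B → y = x) : HasLogs (A ∪ B) := by
  classical
  intro f hf h0
  obtain ⟨L, hL, hLe⟩ := hA f (hf.mono subset_union_left) fun y hy => h0 y (Or.inl hy)
  obtain ⟨M, hM, hMe⟩ := hB f (hf.mono subset_union_right) fun y hy => h0 y (Or.inr hy)
  have hshift : Complex.exp (L x - M x) = 1 := by
    rw [Complex.exp_sub, hLe x hxA, hMe x hxB, div_self (h0 x (Or.inl hxA))]
  have heqB : ∀ y ∈ B, A.piecewise L (fun z => M z + (L x - M x)) y = M y + (L x - M x) := by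
    intro y hy
    by_cases h : y ∈ A
    · rw [hAB y h hy, piecewise_eq_of_mem _ _ _ hxA]; ring
    · rw [piecewise_eq_of_notMem _ _ _ h]
  refine ⟨A.piecewise L (fun z => M z + (L x - M x)), ?_, ?_⟩
  · refine ContinuousOn.union_of_isClosed
      (hL.congr fun y hy => piecewise_eq_of_mem _ _ _ hy) ?_ hAc hBc
    exact (hM.add continuousOn_const).congr heqB
  · rintro y (hy | hy)
    · rw [piecewise_eq_of_mem _ _ _ hy, hLe y hy]
    · rw [heqB y hy, Complex.exp_add, hshift, mul_one, hMe y hy]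

/-- A loop winding once around a circle centred at the origin has no continuous closed
logarithm. -/
theorem log_circle_ne {H : ℝ → ℂ} (hH : Continuous H) {R : ℝ}
    (hexp : ∀ θ : ℝ, Complex.exp (H θ) = R * Complex.exp (θ * Complex.I)) :
    H (2 * Real.pi) ≠ H 0 := by
  intro hper
  have hD : ∀ θ : ℝ, Complex.exp (H θ - θ * Complex.I) = R := fun θ => by
    rw [Complex.exp_sub, hexp, mul_div_assoc, div_self (Complex.exp_ne_zero _), mul_one]
  have hconst := Complex.isCoveringMap_exp.eq_of_comp_eq
    (g₁ := fun θ : ℝ => H θ - θ * Complex.I) (g₂ := fun _ => H 0) (by fun_prop) (by fun_prop)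
    (by
      funext θ
      refine Subtype.ext ?_
      have h0 := hD 0
      simp only [Complex.ofReal_zero, zero_mul, sub_zero] at h0
      exact (hD θ).trans h0.symm) 0 (by simp)
  have := congrFun hconst (2 * Real.pi)
  simp [hper, Real.pi_ne_zero] at this

/-- A closed set carrying logarithms cannot contain the frontier of a bounded set which it
does not cover. -/
theorem HasLogs.not_frontier_subset {A V : Set Plane} (hA : HasLogs A) (hAc : IsClosed A)
    (hVb : Bornology.IsBounded V) (hVA : frontier V ⊆ A) {p : Plane} (hpV : p ∈ V)
    (hpA : p ∉ A) : False := by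
  classical
  let e : Plane ≃L[ℝ] ℂ := Complex.equivRealProdCLM.symm
  have hf : Continuous fun z => e z - e p := by fun_prop
  have hf0 : ∀ z, z ≠ p → e z - e p ≠ 0 := fun z hz => sub_ne_zero.2 (e.injective.ne hz)
  obtain ⟨L, hL, hLe⟩ := hA _ hf.continuousOn fun z hz => hf0 z (by rintro rfl; exact hpA hz)
  obtain ⟨G, hG⟩ := ContinuousMap.exists_restrict_eq hAc
    (⟨A.domRestrict L, continuousOn_iff_continuous_domRestrict.1 hL⟩ : C(A, ℂ))
  have hGA : ∀ z ∈ A, G z = L z := fun z hz => DFunLike.congr_fun hG ⟨z, hz⟩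
  let F : Plane → ℂ := V.piecewise (fun z => Complex.exp (G z)) fun z => e z - e p
  have hF : Continuous F := Continuous.piecewise
    (fun z hz => by rw [hGA z (hVA hz), hLe z (hVA hz)]) (by fun_prop) hf
  have hF0 : ∀ z, F z ≠ 0 := by
    intro z
    by_cases hz : z ∈ V
    · simp [F, hz, Complex.exp_ne_zero]
    · simpa [F, hz] using hf0 z (by rintro rfl; exact hz hpV)
  obtain ⟨H, hH, hHe⟩ := hasLogs_univ_of_contractible F hF.continuousOn fun z _ => hF0 z
  obtain ⟨R, hR⟩ : ∃ R, e '' V ⊆ Metric.ball (e p) R :=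
    (e.lipschitz.isBounded_image hVb).subset_ball (e p)
  have hR0 : 0 < R := Metric.nonempty_ball.1 ⟨_, hR (mem_image_of_mem e hpV)⟩
  let c : ℝ → Plane := fun θ => e.symm (e p + R * Complex.exp (θ * Complex.I))
  have hc : Continuous c := by fun_prop
  refine log_circle_ne (H := H ∘ c) (R := R) ((continuousOn_univ.1 hH).comp hc)
    (fun θ => ?_) (by simp [c])
  have hcV : c θ ∉ V := fun h => by
    have := hR (mem_image_of_mem e h)
    simp [c, Complex.norm_exp_ofReal_mul_I, abs_of_pos hR0] at this
  have hFc : F (c θ) = R * Complex.exp (θ * Complex.I) := by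
    rw [show F (c θ) = e (c θ) - e p from piecewise_eq_of_notMem _ _ _ hcV]
    simp [c]
  exact (hHe (c θ) trivial).trans hFc

/-- A continuous injective function on an interval takes smaller and larger values than at an
interior point. -/
theorem exists_lt_and_exists_gt_of_injOn {h : ℝ → ℝ} {l t r : ℝ} (hl : l < t) (hr : t < r)
    (hc : ContinuousOn h (Icc l r)) (hi : InjOn h (Icc l r)) :
    (∃ u ∈ Icc l r, h u < h t) ∧ ∃ u ∈ Icc l r, h t < h u := by
  have hlm : l ∈ Icc l r := ⟨le_rfl, (hl.trans hr).le⟩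
  have hrm : r ∈ Icc l r := ⟨(hl.trans hr).le, le_rfl⟩
  have htm : t ∈ Icc l r := ⟨hl.le, hr.le⟩
  rcases le_total (h l) (h r) with hle | hle
  · have := hc.strictMonoOn_of_injOn_Icc (hl.trans hr).le hle hi
    exact ⟨⟨l, hlm, this hlm htm hl⟩, r, hrm, this htm hrm hr⟩
  · have := hc.strictAntiOn_of_injOn_Icc (hl.trans hr).le hle hi
    exact ⟨⟨r, hrm, this htm hrm hr⟩, l, hlm, this hlm htm hl⟩

/-- Two embedded lines which differ exactly along the nonempty bounded open intervals `(a, b)`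
and `(c, d)` of their parameters. -/
structure Diverge (φ ψ : ℝ → Plane) (a b c d : ℝ) : Prop where
  left : IsEmbedding φ
  right : IsEmbedding ψ
  left_lt : a < b
  right_lt : c < d
  left_mem : ∀ t, φ t ∈ range ψ ↔ t ∉ Ioo a b
  right_mem : ∀ s, ψ s ∈ range φ ↔ s ∉ Ioo c d

namespace Diverge

variable {φ ψ : ℝ → Plane} {a b c d : ℝ}

theorem symm (h : Diverge φ ψ a b c d) : Diverge ψ φ c d a b :=
  ⟨h.right, h.left, h.right_lt, h.left_lt, h.right_mem, h.left_mem⟩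

/-- Around a parameter outside `[a, b]` the transition between the two parametrizations is a
homeomorphism, so it cannot end at a boundary point of `(c, d)`. -/
theorem eq_endpoint (h : Diverge φ ψ a b c d) {s : ℝ} (hs : s = c ∨ s = d) :
    ψ s = φ a ∨ ψ s = φ b := by
  have hcd := h.right_lt
  obtain ⟨t, ht⟩ : ψ s ∈ range φ := (h.right_mem s).2 (by rcases hs with rfl | rfl <;> simp)
  have htab : t ∉ Ioo a b := (h.left_mem t).1 ⟨s, ht.symm⟩
  by_contra! hne
  have hta : t ≠ a := by rintro rfl; exact hne.1 ht.symm
  have htb : t ≠ b := by rintro rfl; exact hne.2 ht.symm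
  obtain ⟨l, r, hl, hr, hlr⟩ : ∃ l r, l < t ∧ t < r ∧ ∀ u ∈ Icc l r, u ∉ Ioo a b := by
    rcases lt_or_gt_of_ne hta with h' | h'
    · exact ⟨t - 1, a, by linarith, h', fun u hu hu' => absurd hu.2 (not_le.2 hu'.1)⟩
    · have hbt : b < t := lt_of_le_of_ne (not_lt.1 fun h'' => htab ⟨h', h''⟩) htb.symm
      exact ⟨b, t + 1, hbt, by linarith, fun u hu hu' => absurd hu.1 (not_le.2 hu'.2)⟩
  have hmem : MapsTo φ (Icc l r) (range ψ) := fun u hu => (h.left_mem u).2 (hlr u hu)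
  have hinv : ∀ u ∈ Icc l r, ψ (Function.invFun ψ (φ u)) = φ u := fun u hu =>
    Function.invFun_eq (hmem hu)
  have hcont : ContinuousOn (fun u => Function.invFun ψ (φ u)) (Icc l r) :=
    h.right.continuousOn_invFun.comp h.left.continuous.continuousOn hmem
  have hinj : InjOn (fun u => Function.invFun ψ (φ u)) (Icc l r) := fun u hu v hv huv =>
    h.left.injective (by rw [← hinv u hu, ← hinv v hv]; exact congrArg ψ huv)
  have hts : Function.invFun ψ (φ t) = s := by
    rw [ht]; exact Function.leftInverse_invFun h.right.injective s
  have hord := (isPreconnected_Icc.image _ hcont).ordConnected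
  have hav : ∀ x ∈ (fun u => Function.invFun ψ (φ u)) '' Icc l r, x ∉ Ioo c d := by
    rintro _ ⟨u, hu, rfl⟩
    exact (h.right_mem _).1 ⟨u, (hinv u hu).symm⟩
  have hsm : s ∈ (fun u => Function.invFun ψ (φ u)) '' Icc l r := ⟨t, ⟨hl.le, hr.le⟩, hts⟩
  obtain ⟨⟨u, hu, hut⟩, v, hv, hvt⟩ := exists_lt_and_exists_gt_of_injOn hl hr hcont hinj
  simp only [hts] at hut hvt
  rcases hs with rfl | rfl
  · obtain ⟨m, hm, hm'⟩ := exists_between (lt_min hcd hvt)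
    exact hav m (hord.out hsm (mem_image_of_mem _ hv) ⟨hm.le, (hm'.trans_le (min_le_right _ _)).le⟩)
      ⟨hm, hm'.trans_le (min_le_left _ _)⟩
  · obtain ⟨m, hm, hm'⟩ := exists_between (max_lt hcd hut)
    exact hav m (hord.out (mem_image_of_mem _ hu) hsm
      ⟨((le_max_right _ _).trans_lt hm).le, hm'.le⟩) ⟨(le_max_left _ _).trans_lt hm, hm'⟩

theorem left_diff (h : Diverge φ ψ a b c d) : range φ \ range ψ = φ '' Ioo a b := by
  ext z
  constructor
  · rintro ⟨⟨t, rfl⟩, ht⟩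
    exact mem_image_of_mem _ (by_contra fun h' => ht ((h.left_mem t).2 h'))
  · rintro ⟨t, ht, rfl⟩
    exact ⟨mem_range_self t, fun h' => (h.left_mem t).1 h' ht⟩

theorem isClosed_image_Icc (h : Diverge φ ψ a b c d) (l r : ℝ) : IsClosed (φ '' Icc l r) :=
  (isCompact_Icc.image h.left.continuous).isClosed

theorem closure_image_Ioo (h : Diverge φ ψ a b c d) :
    closure (φ '' Ioo a b) = φ '' Icc a b := by
  refine (closure_minimal (image_mono Ioo_subset_Icc_self) (h.isClosed_image_Icc a b)).antisymm ?_
  rw [← closure_Ioo h.left_lt.ne]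
  exact image_closure_subset_closure_image h.left.continuous

theorem lineJ_eq (h : Diverge φ ψ a b c d) :
    lineJ (range φ) (range ψ) = φ '' Icc a b ∪ ψ '' Icc c d := by
  rw [lineJ, Set.symmDiff_def, h.left_diff, h.symm.left_diff, closure_union,
    h.closure_image_Ioo, h.symm.closure_image_Ioo]

theorem endpoint_mem (h : Diverge φ ψ a b c d) {t : ℝ} (ht : t = a ∨ t = b) :
    φ t ∈ ψ '' Icc c d := by
  rcases h.symm.eq_endpoint ht with h' | h' <;> rw [h']
  exacts [mem_image_of_mem _ (left_mem_Icc.2 h.right_lt.le),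
    mem_image_of_mem _ (right_mem_Icc.2 h.right_lt.le)]

theorem mem_right_arc (h : Diverge φ ψ a b c d) {t : ℝ} (ht : φ t ∈ ψ '' Icc c d) :
    t = a ∨ t = b := by
  obtain ⟨s, hs, hst⟩ := ht
  have hs' : s ∉ Ioo c d := (h.right_mem s).1 ⟨t, hst.symm⟩
  have : s = c ∨ s = d := by
    by_contra! hne
    exact hs' ⟨lt_of_le_of_ne hs.1 hne.1.symm, lt_of_le_of_ne hs.2 hne.2⟩
  rcases h.eq_endpoint this with h' | h' <;> rw [hst] at h'
  exacts [Or.inl (h.left.injective h'), Or.inr (h.left.injective h')]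

theorem mem_lineJ_iff (h : Diverge φ ψ a b c d) {t : ℝ} :
    φ t ∈ lineJ (range φ) (range ψ) ↔ t ∈ Icc a b := by
  rw [h.lineJ_eq]
  refine ⟨?_, fun ht => Or.inl (mem_image_of_mem _ ht)⟩
  rintro (ht | ht)
  · exact h.left.injective.mem_set_image.1 ht
  · rcases h.mem_right_arc ht with rfl | rfl
    exacts [left_mem_Icc.2 h.left_lt.le, right_mem_Icc.2 h.left_lt.le]

/-- Every bounded set whose frontier lies in the Jordan curve `lineJ` has all of the open arc
`φ '' Ioo a b` in its frontier. -/
theorem mem_frontier (h : Diverge φ ψ a b c d) {V : Set Plane} (hVb : Bornology.IsBounded V)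
    (hVJ : frontier V ⊆ lineJ (range φ) (range ψ)) {t : ℝ} (ht : t ∈ Ioo a b) {p : Plane}
    (hpV : p ∈ V) (hp : p ∉ lineJ (range φ) (range ψ) ∨ p = φ t) : φ t ∈ frontier V := by
  by_contra htV
  have hopen : IsOpen (φ ⁻¹' (frontier V)ᶜ ∩ Ioo a b) :=
    (isClosed_frontier.isOpen_compl.preimage h.left.continuous).inter isOpen_Ioo
  obtain ⟨ε, hε, hball⟩ := Metric.isOpen_iff.1 hopen t ⟨htV, ht⟩
  rw [Real.ball_eq_Ioo] at hball
  obtain ⟨l, hl, hlt⟩ := exists_between (show t - ε < t by linarith)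
  obtain ⟨r, htr, hr⟩ := exists_between (show t < t + ε by linarith)
  have hal : a < l := (hball ⟨hl, by linarith⟩).2.1
  have hrb : r < b := (hball ⟨by linarith, hr⟩).2.2
  have hlog : HasLogs (φ '' Icc a l ∪ ψ '' Icc c d ∪ φ '' Icc r b) := by
    refine ((hasLogs_image_Icc h.left hal.le).union (hasLogs_image_Icc h.right h.right_lt.le)
      (h.isClosed_image_Icc _ _) (h.symm.isClosed_image_Icc _ _) (x := φ a)
      (mem_image_of_mem _ (left_mem_Icc.2 hal.le)) (h.endpoint_mem (Or.inl rfl)) ?_).union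
      (hasLogs_image_Icc h.left hrb.le)
      ((h.isClosed_image_Icc _ _).union (h.symm.isClosed_image_Icc _ _))
      (h.isClosed_image_Icc _ _) (x := φ b) (Or.inr (h.endpoint_mem (Or.inr rfl)))
      (mem_image_of_mem _ (right_mem_Icc.2 hrb.le)) ?_
    · rintro _ ⟨u, hu, rfl⟩ hu'
      rcases h.mem_right_arc hu' with rfl | rfl
      · rfl
      · linarith [hu.2, ht.2]
    · rintro _ (hu' | hu') ⟨u, hu, rfl⟩
      · have := (h.left.injective.mem_set_image.1 hu').2
        linarith [hu.1]
      · rcases h.mem_right_arc hu' with rfl | rfl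
        · linarith [hu.1, ht.1]
        · rfl
  refine hlog.not_frontier_subset (((h.isClosed_image_Icc _ _).union
    (h.symm.isClosed_image_Icc _ _)).union (h.isClosed_image_Icc _ _)) hVb ?_ hpV ?_
  · intro z hz
    have hzJ := hVJ hz
    rw [h.lineJ_eq] at hzJ
    rcases hzJ with ⟨u, hu, rfl⟩ | hzJ
    · rcases le_or_gt u l with hul | hul
      · exact Or.inl (Or.inl (mem_image_of_mem _ ⟨hu.1, hul⟩))
      rcases le_or_gt r u with hru | hru
      · exact Or.inr (mem_image_of_mem _ ⟨hru, hu.2⟩)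
      · exact absurd hz (hball ⟨hl.trans hul, hru.trans hr⟩).1
    · exact Or.inl (Or.inr hzJ)
  · rcases hp with hp | rfl
    · rw [h.lineJ_eq] at hp
      refine fun hpA => hp ?_
      rcases hpA with (hpA | hpA) | hpA
      · exact Or.inl (image_mono (Icc_subset_Icc_right (by linarith)) hpA)
      · exact Or.inr hpA
      · exact Or.inl (image_mono (Icc_subset_Icc_left (by linarith)) hpA)
    · rintro ((hpA | hpA) | hpA)
      · linarith [(h.left.injective.mem_set_image.1 hpA).2]
      · rcases h.mem_right_arc hpA with rfl | rfl
        · exact lt_irrefl _ ht.1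
        · exact lt_irrefl _ ht.2
      · linarith [(h.left.injective.mem_set_image.1 hpA).1]

end Diverge

theorem mem_intRegion_of_mem_component {J : Set Plane} {x y : Plane} (hx : x ∈ intRegion J)
    (hy : y ∈ connectedComponentIn Jᶜ x) : y ∈ intRegion J :=
  ⟨connectedComponentIn_subset _ _ hy, connectedComponentIn_eq hy ▸ hx.2⟩

theorem mem_extRegion_of_mem_component {J : Set Plane} {x y : Plane} (hx : x ∈ extRegion J)
    (hy : y ∈ connectedComponentIn Jᶜ x) : y ∈ extRegion J :=
  ⟨connectedComponentIn_subset _ _ hy, connectedComponentIn_eq hy ▸ hx.2⟩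

theorem IsClosed.frontier_component_subset {J : Set Plane} (hJ : IsClosed J) (w : Plane) :
    frontier (connectedComponentIn Jᶜ w) ⊆ J := by
  intro x hx
  by_contra hxJ
  obtain ⟨y, hyx, hyw⟩ := mem_closure_iff.1 hx.1 _ hJ.isOpen_compl.connectedComponentIn
    (mem_connectedComponentIn hxJ)
  refine hx.2 (hJ.isOpen_compl.connectedComponentIn.interior_eq.symm ▸ ?_)
  rw [connectedComponentIn_eq hyw, ← connectedComponentIn_eq hyx]
  exact mem_connectedComponentIn hxJ

theorem IsClosed.isOpen_extRegion {J : Set Plane} (hJ : IsClosed J) : IsOpen (extRegion J) :=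
  isOpen_iff_forall_mem_open.2 fun x hx => ⟨connectedComponentIn Jᶜ x,
    fun _ hy => mem_extRegion_of_mem_component hx hy, hJ.isOpen_compl.connectedComponentIn,
    mem_connectedComponentIn hx.1⟩

theorem IsClosed.frontier_compl_closure_extRegion_subset {J : Set Plane} (hJ : IsClosed J) :
    frontier (closure (extRegion J))ᶜ ⊆ J := by
  intro x hx
  rw [frontier_compl] at hx
  have hxE : x ∈ closure (extRegion J) := closure_closure (s := extRegion J) ▸ hx.1
  have hxn : x ∉ extRegion J := fun h =>
    hx.2 (interior_mono subset_closure (hJ.isOpen_extRegion.interior_eq.symm ▸ h))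
  by_contra hxJ
  obtain ⟨y, hyx, hy⟩ := mem_closure_iff.1 hxE _ hJ.isOpen_compl.connectedComponentIn
    (mem_connectedComponentIn hxJ)
  refine hxn (mem_extRegion_of_mem_component hy ?_)
  rw [← connectedComponentIn_eq hyx]
  exact mem_connectedComponentIn hxJ

theorem isBounded_compl_closure_extRegion {J : Set Plane} (hJ : Bornology.IsBounded J) :
    Bornology.IsBounded (closure (extRegion J))ᶜ := by
  obtain ⟨R, hR0, hR⟩ := hJ.subset_closedBall_lt 0 0
  refine (Metric.isBounded_closedBall (x := (0 : Plane)) (r := R)).subset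
    (compl_subset_comm.1 fun z hz => subset_closure ?_)
  have hz : R < ‖z‖ := by simpa using hz
  have hray : (fun s : ℝ => s • z) '' Ici 1 ⊆ connectedComponentIn Jᶜ z := by
    refine (isPreconnected_Ici.image _ (by fun_prop)).subset_connectedComponentIn
      ⟨1, self_mem_Ici, one_smul _ _⟩ ?_
    rintro _ ⟨s, hs, rfl⟩ hsJ
    have h1 : ‖s • z‖ ≤ R := by simpa using hR hsJ
    rw [norm_smul, Real.norm_of_nonneg (zero_le_one.trans hs)] at h1
    nlinarith [mem_Ici.1 hs, norm_nonneg z]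
  refine ⟨fun h => ?_, fun hb => ?_⟩
  · exact absurd (by simpa using hR h) (not_le.2 hz)
  · obtain ⟨M, hM⟩ := (hb.subset hray).subset_closedBall 0
    have h1 : ∀ s : ℝ, 1 ≤ s → s * ‖z‖ ≤ M := fun s hs => by
      have : ‖s • z‖ ≤ M := by simpa using hM (mem_image_of_mem _ (mem_Ici.2 hs))
      rwa [norm_smul, Real.norm_of_nonneg (zero_le_one.trans hs)] at this
    have hz0 : 0 < ‖z‖ := hR0.trans hz
    have h2 := h1 (max 1 ((M + 1) / ‖z‖)) (le_max_left _ _)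
    have h3 : (M + 1) / ‖z‖ * ‖z‖ ≤ max 1 ((M + 1) / ‖z‖) * ‖z‖ :=
      mul_le_mul_of_nonneg_right (le_max_right _ _) hz0.le
    rw [div_mul_cancel₀ _ hz0.ne'] at h3
    linarith

theorem lineJ_comm (γ γ' : Set Plane) : lineJ γ γ' = lineJ γ' γ := by
  rw [lineJ, lineJ, symmDiff_comm]

namespace Diverge

variable {φ ψ : ℝ → Plane} {a b c d : ℝ}

theorem isClosed_lineJ : IsClosed (lineJ (range φ) (range ψ)) := isClosed_closure

theorem isBounded_lineJ (h : Diverge φ ψ a b c d) :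
    Bornology.IsBounded (lineJ (range φ) (range ψ)) := by
  rw [h.lineJ_eq]
  exact (isCompact_Icc.image h.left.continuous).isBounded.union
    (isCompact_Icc.image h.right.continuous).isBounded

theorem image_Ioo_subset_closure_extRegion (h : Diverge φ ψ a b c d) :
    φ '' Ioo a b ⊆ closure (extRegion (lineJ (range φ) (range ψ))) := by
  rintro _ ⟨t, ht, rfl⟩
  by_contra hV
  have := h.mem_frontier (isBounded_compl_closure_extRegion h.isBounded_lineJ)
    isClosed_lineJ.frontier_compl_closure_extRegion_subset ht hV (Or.inr rfl)
  rw [isClosed_closure.isOpen_compl.frontier_eq] at this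
  exact this.2 hV

theorem image_Ioo_subset_closure_intRegion (h : Diverge φ ψ a b c d) {w : Plane}
    (hw : w ∈ intRegion (lineJ (range φ) (range ψ))) :
    φ '' Ioo a b ⊆ closure (intRegion (lineJ (range φ) (range ψ))) := by
  rintro _ ⟨t, ht, rfl⟩
  refine closure_mono (fun _ hy => mem_intRegion_of_mem_component hw hy) ?_
  exact frontier_subset_closure (h.mem_frontier hw.2 (isClosed_lineJ.frontier_component_subset w)
    ht (mem_connectedComponentIn hw.1) (Or.inl hw.1))

theorem lineJ_subset_closure (h : Diverge φ ψ a b c d) {S : Set Plane}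
    (hφ : φ '' Ioo a b ⊆ closure S) (hψ : ψ '' Ioo c d ⊆ closure S) :
    lineJ (range φ) (range ψ) ⊆ closure S := by
  rw [h.lineJ_eq, ← h.closure_image_Ioo, ← h.symm.closure_image_Ioo]
  exact union_subset (closure_minimal hφ isClosed_closure) (closure_minimal hψ isClosed_closure)

theorem lineJ_subset_closure_extRegion (h : Diverge φ ψ a b c d) :
    lineJ (range φ) (range ψ) ⊆ closure (extRegion (lineJ (range φ) (range ψ))) :=
  h.lineJ_subset_closure h.image_Ioo_subset_closure_extRegion
    (lineJ_comm (range φ) (range ψ) ▸ h.symm.image_Ioo_subset_closure_extRegion)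

theorem lineJ_subset_closure_intRegion (h : Diverge φ ψ a b c d)
    (hne : (intRegion (lineJ (range φ) (range ψ))).Nonempty) :
    lineJ (range φ) (range ψ) ⊆ closure (intRegion (lineJ (range φ) (range ψ))) := by
  obtain ⟨w, hw⟩ := hne
  refine h.lineJ_subset_closure (h.image_Ioo_subset_closure_intRegion hw) ?_
  rw [lineJ_comm] at hw ⊢
  exact h.symm.image_Ioo_subset_closure_intRegion hw

end Diverge

/-- A line is not contained in another one from which it differs by a portion. -/
theorem not_subset_of_isPortion {φ ψ : ℝ → Plane} (hφ : Continuous φ) (hψ : IsEmbedding ψ)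
    (hne : range φ ≠ range ψ) {c d : ℝ} (hcd : ∀ s, ψ s ∈ range φ ↔ s ∉ Ioo c d) :
    ¬ range φ ⊆ range ψ := by
  intro hsub
  have himage : ψ '' (Ioo c d)ᶜ = range φ := by
    ext z
    constructor
    · rintro ⟨s, hs, rfl⟩
      exact (hcd s).2 hs
    · intro hz
      obtain ⟨s, rfl⟩ := hsub hz
      exact mem_image_of_mem _ ((hcd s).1 hz)
  have hord : ((Ioo c d)ᶜ : Set ℝ).OrdConnected := by
    refine IsPreconnected.ordConnected (hψ.isInducing.isPreconnected_image.1 ?_)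
    rw [himage]
    exact isPreconnected_range hφ
  have hemp : Ioo c d = ∅ := by
    refine eq_empty_of_forall_notMem fun s hs => ?_
    exact hord.out (show c ∈ (Ioo c d)ᶜ by simp) (show d ∈ (Ioo c d)ᶜ by simp)
      ⟨hs.1.le, hs.2.le⟩ hs
  exact hne (by rw [← himage, hemp, compl_empty, image_univ])

theorem IsPortion.exists_Ioo {φ : ℝ → Plane} (hφ : IsEmbedding φ) {γ' : Set Plane}
    (h : IsPortion (range φ) (range φ \ γ')) :
    ∃ a b : ℝ, ∀ t, φ t ∈ γ' ↔ t ∉ Ioo a b := by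
  obtain ⟨a, b, hab⟩ := h.2 hφ.toHomeomorph
  refine ⟨a, b, fun t => ?_⟩
  rw [← hab]
  simp

theorem exists_diverge {φ ψ : ℝ → Plane} (hφ : IsEmbedding φ) (hψ : IsEmbedding ψ)
    (hne : range φ ≠ range ψ) (h : IsPortion (range φ) (range φ \ range ψ))
    (h' : IsPortion (range ψ) (range ψ \ range φ)) : ∃ a b c d, Diverge φ ψ a b c d := by
  obtain ⟨a, b, hab⟩ := h.exists_Ioo hφ
  obtain ⟨c, d, hcd⟩ := h'.exists_Ioo hψ
  have lt_of_not_subset : ∀ {f g : ℝ → Plane} {l r : ℝ}, (∀ t, f t ∈ range g ↔ t ∉ Ioo l r) →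
      ¬ range f ⊆ range g → l < r := by
    intro f g l r hlr hsub
    by_contra hle
    refine hsub ?_
    rintro _ ⟨t, rfl⟩
    exact (hlr t).2 fun ht => hle (ht.1.trans ht.2)
  exact ⟨a, b, c, d, hφ, hψ,
    lt_of_not_subset hab (not_subset_of_isPortion hφ.continuous hψ hne hcd),
    lt_of_not_subset hcd (not_subset_of_isPortion hψ.continuous hφ hne.symm hab), hab, hcd⟩

theorem IsTopLine.exists_isEmbedding {γ : Set Plane} (h : IsTopLine γ) :
    ∃ φ : ℝ → Plane, IsEmbedding φ ∧ range φ = γ := by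
  obtain ⟨Φ⟩ := h
  refine ⟨fun t => Φ t, IsEmbedding.subtypeVal.comp Φ.isEmbedding, ?_⟩
  rw [show (fun t => (Φ t : Plane)) = Subtype.val ∘ Φ from rfl, range_comp, Φ.surjective.range_eq,
    image_univ, Subtype.range_coe]

/-- Away from the first Jordan curve, the second one is connected. -/
theorem Diverge.isPreconnected_lineJ_diff {φ ψ χ : ℝ → Plane} {a b c d a' b' g k : ℝ}
    {m n m' n' : ℝ} (h : Diverge φ ψ a b c d) (h' : Diverge φ χ a' b' g k)
    (h'' : Diverge ψ χ m n m' n') :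
    IsPreconnected (lineJ (range φ) (range χ) \ lineJ (range φ) (range ψ)) := by
  set J := lineJ (range φ) (range ψ) with hJ
  set W := (range χ \ range φ) ∩ (range χ \ range ψ) with hW
  have hWpre : IsPreconnected W := by
    rw [hW, h'.symm.left_diff, h''.symm.left_diff, ← image_inter h'.right.injective,
      Ioo_inter_Ioo]
    exact isPreconnected_Ioo.image _ h'.right.continuous.continuousOn
  have hlow : IsPreconnected (φ '' (Icc a' b' ∩ Iio a)) :=
    ((ordConnected_Icc.inter ordConnected_Iio).isPreconnected).image _
      h.left.continuous.continuousOn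
  have hupp : IsPreconnected (φ '' (Icc a' b' ∩ Ioi b)) :=
    ((ordConnected_Icc.inter ordConnected_Ioi).isPreconnected).image _
      h.left.continuous.continuousOn
  have hdiffJ : range ψ \ range φ ⊆ J := fun z hz => subset_closure (Or.inr hz)
  have hJsub : J ⊆ range φ ∪ range ψ := by
    rw [hJ, h.lineJ_eq]
    exact union_subset_union (image_subset_range _ _) (image_subset_range _ _)
  -- an endpoint of the second curve off the first one is a limit of `W`
  have hlim : ∀ t, (t = a' ∨ t = b') → t ∉ Icc a b → φ t ∈ closure W := by
    intro t ht htab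
    have htJ : φ t ∉ J := fun hmem => htab (h.mem_lineJ_iff.1 hmem)
    have hcl : φ t ∈ closure (range χ \ range φ) := by
      rw [h'.symm.left_diff, h'.symm.closure_image_Ioo]
      exact h'.endpoint_mem ht
    refine mem_closure_iff.2 fun o ho hto => ?_
    obtain ⟨z, ⟨hzo, hzJ⟩, hz⟩ := mem_closure_iff.1 hcl (o ∩ Jᶜ)
      (ho.inter Diverge.isClosed_lineJ.isOpen_compl) ⟨hto, htJ⟩
    exact ⟨z, hzo, hz, hz.1, fun hzψ => hzJ (hdiffJ ⟨hzψ, hz.2⟩)⟩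
  have hpart : lineJ (range φ) (range χ) \ J =
      W ∪ φ '' (Icc a' b' ∩ Iio a) ∪ φ '' (Icc a' b' ∩ Ioi b) := by
    ext z
    constructor
    · rintro ⟨hz, hzJ⟩
      by_cases hzφ : z ∈ range φ
      · obtain ⟨t, rfl⟩ := hzφ
        have ht := h'.mem_lineJ_iff.1 hz
        have ht' : t ∉ Icc a b := fun hmem => hzJ (h.mem_lineJ_iff.2 hmem)
        rcases lt_or_ge t a with hta | hta
        · exact Or.inl (Or.inr (mem_image_of_mem _ ⟨ht, hta⟩))
        · exact Or.inr (mem_image_of_mem _ ⟨ht, not_le.1 fun htb => ht' ⟨hta, htb⟩⟩)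
      · have hzχ : z ∈ range χ := by
          rw [h'.lineJ_eq] at hz
          rcases hz with hz | hz
          · exact absurd (image_subset_range _ _ hz) hzφ
          · exact image_subset_range _ _ hz
        exact Or.inl (Or.inl ⟨⟨hzχ, hzφ⟩, hzχ, fun hzψ => hzJ (hdiffJ ⟨hzψ, hzφ⟩)⟩)
    · rintro ((hz | ⟨t, ⟨ht, hta⟩, rfl⟩) | ⟨t, ⟨ht, htb⟩, rfl⟩)
      · refine ⟨subset_closure (Or.inr hz.1), fun hzJ => ?_⟩
        rcases hJsub hzJ with hz' | hz'
        exacts [hz.1.2 hz', hz.2.2 hz']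
      · exact ⟨h'.mem_lineJ_iff.2 ht, fun hmem => not_le.2 hta (h.mem_lineJ_iff.1 hmem).1⟩
      · exact ⟨h'.mem_lineJ_iff.2 ht, fun hmem => not_le.2 htb (h.mem_lineJ_iff.1 hmem).2⟩
  -- a connected set meeting `closure W` may be attached to a connected set containing `W`
  have attach : ∀ {X Y : Set Plane}, IsPreconnected X → W ⊆ X → IsPreconnected Y →
      (Y.Nonempty → (closure W ∩ Y).Nonempty) → IsPreconnected (X ∪ Y) := by
    intro X Y hX hWX hY hYW
    rcases Y.eq_empty_or_nonempty with rfl | hYne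
    · rwa [union_empty]
    obtain ⟨z, hzW, hzY⟩ := hYW hYne
    have hXz : IsPreconnected (insert z X) :=
      hX.subset_closure (subset_insert _ _)
        (insert_subset (closure_mono hWX hzW) subset_closure)
    have := hXz.union z (mem_insert _ _) hzY hY
    rwa [insert_union, insert_eq_of_mem (mem_union_right X hzY)] at this
  rw [hpart]
  refine attach (attach hWpre Subset.rfl hlow ?_) subset_union_left hupp ?_
  · rintro ⟨_, t, ⟨ht, hta⟩, rfl⟩
    have ha : a' < a := lt_of_le_of_lt ht.1 hta
    exact ⟨φ a', hlim a' (Or.inl rfl) fun hmem => not_le.2 ha hmem.1,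
      mem_image_of_mem _ ⟨left_mem_Icc.2 h'.left_lt.le, ha⟩⟩
  · rintro ⟨_, t, ⟨ht, htb⟩, rfl⟩
    have hb : b < b' := lt_of_lt_of_le htb ht.2
    exact ⟨φ b', hlim b' (Or.inr rfl) fun hmem => not_le.2 hb hmem.2,
      mem_image_of_mem _ ⟨right_mem_Icc.2 h'.left_lt.le, hb⟩⟩

theorem stmt9 (Γ : Set (Set Plane)) (hline : ∀ γ ∈ Γ, IsTopLine γ)
    (hport : ∀ γ ∈ Γ, ∀ γ' ∈ Γ, γ ≠ γ' → IsPortion γ (γ \ γ'))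
    (γ γ' σ : Set Plane) (hγ : γ ∈ Γ) (hγ' : γ' ∈ Γ) (hσ : σ ∈ Γ)
    (h1 : γ ≠ γ') (h2 : γ ≠ σ) (h3 : γ' ≠ σ) :
    lineJ γ σ ⊆ closure (intRegion (lineJ γ γ')) ∨
      lineJ γ σ ⊆ closure (extRegion (lineJ γ γ')) := by
  obtain ⟨φ, hφ, rfl⟩ := (hline γ hγ).exists_isEmbedding
  obtain ⟨ψ, hψ, rfl⟩ := (hline γ' hγ').exists_isEmbedding
  obtain ⟨χ, hχ, rfl⟩ := (hline σ hσ).exists_isEmbedding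
  obtain ⟨a, b, c, d, h⟩ := exists_diverge hφ hψ h1 (hport _ hγ _ hγ' h1)
    (hport _ hγ' _ hγ h1.symm)
  obtain ⟨_, _, _, _, h'⟩ := exists_diverge hφ hχ h2 (hport _ hγ _ hσ h2)
    (hport _ hσ _ hγ h2.symm)
  obtain ⟨_, _, _, _, h''⟩ := exists_diverge hψ hχ h3 (hport _ hγ' _ hσ h3)
    (hport _ hσ _ hγ' h3.symm)
  have hpre := h.isPreconnected_lineJ_diff h' h''
  have hext := h.lineJ_subset_closure_extRegion
  have hint := h.lineJ_subset_closure_intRegion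
  set J := lineJ (range φ) (range ψ)
  have hcover : ∀ S : Set Plane, J ⊆ closure S → lineJ (range φ) (range χ) \ J ⊆ S →
      lineJ (range φ) (range χ) ⊆ closure S := by
    intro S hJS hS z hz
    by_cases hzJ : z ∈ J
    exacts [hJS hzJ, subset_closure (hS ⟨hz, hzJ⟩)]
  by_cases hemp : (lineJ (range φ) (range χ) \ J).Nonempty
  · obtain ⟨w, hw⟩ := hemp
    have hcomp := hpre.subset_connectedComponentIn hw fun z hz => hz.2
    by_cases hb : Bornology.IsBounded (connectedComponentIn Jᶜ w)
    · exact Or.inl (hcover _ (hint ⟨w, hw.2, hb⟩) fun z hz =>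
        mem_intRegion_of_mem_component ⟨hw.2, hb⟩ (hcomp hz))
    · exact Or.inr (hcover _ hext fun z hz =>
        mem_extRegion_of_mem_component ⟨hw.2, hb⟩ (hcomp hz))
  · rw [not_nonempty_iff_eq_empty] at hemp
    exact Or.inr (hcover _ hext (hemp ▸ empty_subset _))
end

section
/- Let Γ be a set of topological lines in ℝ² such that γ \ γ' is a portion of γ for all distinct γ, γ' ∈ Γ; for distinct γ, γ' write J(γ,γ') := cl(γ △ γ') (a Jordan curve) and define the relation σ ∈ (γ, γ')_Γ iff J(γ, σ) ⊂ cl(Int J(γ, γ')). Then this relation is symmetric in the last two arguments: for all distinct γ, γ', σ ∈ Γ, σ ∈ (γ, γ')_Γ if and only if σ ∈ (γ', γ)_Γ. -/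
/-- The betweenness relation: `σ` lies between `γ` and `γ'`. -/
def Between (γ γ' σ : Set Plane) : Prop :=
  lineJ γ σ ⊆ closure (intRegion (lineJ γ γ'))

open Set Topology

/-- The function `f` admits a continuous logarithm on the set `s`. -/
def HasLogOn {X : Type*} [TopologicalSpace X] (f : X → ℂ) (s : Set X) : Prop :=
  ∃ g : X → ℂ, ContinuousOn g s ∧ ∀ x ∈ s, Complex.exp (g x) = f x

theorem exists_continuous_log {X : Type*} [TopologicalSpace X] [SimplyConnectedSpace X]
    [LocallyPathConnectedSpace X] {f : X → ℂ} (hf : Continuous f) (h0 : ∀ x, f x ≠ 0) :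
    ∃ g : X → ℂ, Continuous g ∧ ∀ x, Complex.exp (g x) = f x := by
  obtain ⟨x₀⟩ : Nonempty X := inferInstance
  obtain ⟨F, ⟨-, hF⟩, -⟩ := Complex.isCoveringMapOn_exp.existsUnique_continuousMap_lifts
    ⟨f, hf⟩ (a₀ := x₀) (Complex.exp_log (h0 x₀)) h0
  exact ⟨F, F.continuous, congrFun hF⟩

theorem eq_of_exp_eq_exp {X : Type*} [TopologicalSpace X] [SimplyConnectedSpace X]
    [LocallyPathConnectedSpace X] {g h : X → ℂ} (hg : Continuous g) (hh : Continuous h)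
    (hgh : ∀ x, Complex.exp (g x) = Complex.exp (h x)) {x₀ : X} (h₀ : g x₀ = h x₀) : g = h := by
  have key := (Complex.isCoveringMapOn_exp.existsUnique_continuousMap_lifts
    ⟨fun x => Complex.exp (h x), by fun_prop⟩ (a₀ := x₀) (e₀ := h x₀) rfl
    (fun x => Complex.exp_ne_zero _)).unique (y₁ := ⟨g, hg⟩) (y₂ := ⟨h, hh⟩)
    ⟨h₀, funext hgh⟩ ⟨rfl, rfl⟩
  exact congrArg DFunLike.coe key

/-- Continuous logarithms on two closed sets meeting in at most one point can be glued. -/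
theorem HasLogOn.union {X : Type*} [TopologicalSpace X] {f : X → ℂ} {s t : Set X} {p : X}
    (hs : HasLogOn f s) (ht : HasLogOn f t) (hsc : IsClosed s) (htc : IsClosed t)
    (hst : s ∩ t ⊆ {p}) : HasLogOn f (s ∪ t) := by
  classical
  obtain ⟨g, hg, hgf⟩ := hs
  obtain ⟨k, hk, hkf⟩ := ht
  obtain ⟨c, hc, hcp⟩ : ∃ c : ℂ, Complex.exp c = 1 ∧ ∀ x ∈ s ∩ t, g x = k x + c := by
    by_cases hp : p ∈ s ∩ t
    · refine ⟨g p - k p, ?_, fun x hx => ?_⟩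
      · rw [Complex.exp_sub, hgf p hp.1, hkf p hp.2, div_self]
        rw [← hgf p hp.1]
        exact Complex.exp_ne_zero _
      · rw [hst hx]
        ring
    · refine ⟨0, Complex.exp_zero, fun x hx => ?_⟩
      exact absurd (hst hx ▸ hx) hp
  have hleft : EqOn (s.piecewise g fun x => k x + c) g s := piecewise_eqOn _ _ _
  have hright : EqOn (s.piecewise g fun x => k x + c) (fun x => k x + c) t := fun x hx => by
    by_cases hxs : x ∈ s
    · rw [piecewise_eq_of_mem _ _ _ hxs, hcp x ⟨hxs, hx⟩]
    · rw [piecewise_eq_of_notMem _ _ _ hxs]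
  refine ⟨s.piecewise g fun x => k x + c, ?_, ?_⟩
  · exact (hg.congr hleft).union_of_isClosed
      ((hk.add continuousOn_const).congr hright) hsc htc
  · rintro x (hx | hx)
    · rw [hleft hx, hgf x hx]
    · rw [hright hx, Complex.exp_add, hc, mul_one, hkf x hx]

/-- A nonvanishing function on a compact arc of a topological line has a continuous logarithm. -/
theorem hasLogOn_arc {X : Type*} [TopologicalSpace X] {γ : Set X} (Φ : ℝ ≃ₜ γ) {f : X → ℂ}
    (hf : Continuous f) {a b : ℝ} (h0 : ∀ t ∈ Icc a b, f (Φ t) ≠ 0) :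
    HasLogOn f ((fun t => (Φ t : X)) '' Icc a b) := by
  classical
  rcases lt_or_ge b a with hab | hab
  · simp [Icc_eq_empty hab.not_ge, HasLogOn]
  obtain ⟨G, hG, hGf⟩ := exists_continuous_log
    (f := fun t : ℝ => f (Φ (projIcc a b hab t)))
    (by fun_prop) (fun t => h0 _ (projIcc a b hab t).2)
  refine ⟨fun x => if h : x ∈ γ then G (Φ.symm ⟨x, h⟩) else 0, ?_, ?_⟩
  · have : ContinuousOn (fun x => if h : x ∈ γ then G (Φ.symm ⟨x, h⟩) else 0) γ := by
      rw [continuousOn_iff_continuous_domRestrict]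
      have h : γ.domRestrict (fun x => if h : x ∈ γ then G (Φ.symm ⟨x, h⟩) else 0) =
          fun x => G (Φ.symm x) := by
        ext x
        simp
      rw [h]
      fun_prop
    refine this.mono ?_
    rintro _ ⟨t, -, rfl⟩
    exact (Φ t).2
  · rintro _ ⟨t, ht, rfl⟩
    simp [hGf, projIcc_of_mem hab ht]

/-- The displacement from `q` in the plane, as a complex number. -/
noncomputable def displacement (q z : Plane) : ℂ := Complex.equivRealProdCLM.symm (z - q)

theorem continuous_displacement (q : Plane) : Continuous (displacement q) := by
  unfold displacement
  fun_prop

theorem displacement_ne_zero {q z : Plane} (h : z ≠ q) : displacement q z ≠ 0 := by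
  simpa [displacement, sub_eq_zero] using h

/-- The displacement from a point of a bounded set has no continuous logarithm on the
frontier of that set. -/
theorem not_hasLogOn_frontier {U : Set Plane} (hb : Bornology.IsBounded U) {q : Plane}
    (hq : q ∈ U) : ¬ HasLogOn (displacement q) (frontier U) := by
  classical
  rintro ⟨g, hg, hgf⟩
  obtain ⟨g', hg'⟩ := ContinuousMap.exists_restrict_eq isClosed_frontier
    ⟨(frontier U).domRestrict g, hg.domRestrict⟩
  have hg'f : ∀ x ∈ frontier U, Complex.exp (g' x) = displacement q x := fun x hx => by
    rw [← hgf x hx]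
    exact congrArg Complex.exp (DFunLike.congr_fun hg' ⟨x, hx⟩)
  obtain ⟨H, hH, hHf⟩ := exists_continuous_log
    (f := U.piecewise (fun x => Complex.exp (g' x)) (displacement q))
    (Continuous.piecewise hg'f (by fun_prop) (continuous_displacement q))
    (fun x => by
      by_cases hx : x ∈ U
      · simp [hx]
      · have hxq : x ≠ q := fun h => hx (h ▸ hq)
        simpa [hx] using displacement_ne_zero hxq)
  obtain ⟨C, hC⟩ := hb.isCompact_closure.exists_bound_of_continuousOn
    (continuous_displacement q).continuousOn
  have hC0 : 0 ≤ C := (norm_nonneg _).trans (hC q (subset_closure hq))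
  let c : ℝ → Plane := fun θ =>
    q + Complex.equivRealProdCLM (((C + 1 : ℝ) : ℂ) * Complex.exp (θ * Complex.I))
  have hc : Continuous c := by fun_prop
  have hdc : ∀ θ, displacement q (c θ) = ((C + 1 : ℝ) : ℂ) * Complex.exp (θ * Complex.I) :=
    fun θ => by
      rw [displacement, add_sub_cancel_left, ContinuousLinearEquiv.symm_apply_apply]
  have hcU : ∀ θ, c θ ∉ U := fun θ h => by
    have := hC _ (subset_closure h)
    rw [hdc, norm_mul, Complex.norm_exp_ofReal_mul_I, Complex.norm_real, Real.norm_eq_abs,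
      abs_of_pos (by linarith)] at this
    linarith
  have hHc : ∀ θ, Complex.exp (H (c θ)) = ((C + 1 : ℝ) : ℂ) * Complex.exp (θ * Complex.I) :=
    fun θ => by rw [hHf, piecewise_eq_of_notMem _ _ _ (hcU θ), hdc]
  have heq : (fun θ : ℝ => H (c θ)) = fun θ : ℝ => H (c 0) + θ * Complex.I :=
    eq_of_exp_eq_exp (by fun_prop) (by fun_prop)
      (fun θ => by rw [Complex.exp_add, hHc, hHc]; simp) (x₀ := 0) (by simp)
  have hper : c (2 * Real.pi) = c 0 := by simp [c]
  have := congrFun heq (2 * Real.pi)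
  simp [hper, Real.pi_ne_zero] at this

theorem frontier_connectedComponentIn_subset {X : Type*} [TopologicalSpace X]
    [LocallyConnectedSpace X] {J : Set X} (hJ : IsClosed J) (q : X) :
    frontier (connectedComponentIn Jᶜ q) ⊆ J := by
  intro x hx
  by_contra hxJ
  have hopen : ∀ y, IsOpen (connectedComponentIn Jᶜ y) := fun y =>
    hJ.isOpen_compl.connectedComponentIn
  obtain ⟨y, hyx, hyq⟩ := mem_closure_iff.1 hx.1 _ (hopen x) (mem_connectedComponentIn hxJ)
  have h := (connectedComponentIn_eq hyq).trans (connectedComponentIn_eq hyx).symm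
  apply hx.2
  rw [(hopen q).interior_eq, h]
  exact mem_connectedComponentIn hxJ

/-- The closure of a nonempty portion of a topological line is a compact arc. -/
theorem closure_portion {γ π : Set Plane} (hπ : π ⊆ γ) (Φ : ℝ ≃ₜ γ) {a b : ℝ}
    (h : {t : ℝ | (Φ t : Plane) ∈ π} = Ioo a b) (hab : a < b) :
    closure π = (fun t => (Φ t : Plane)) '' Icc a b := by
  have hcont : Continuous fun t => (Φ t : Plane) := by fun_prop
  have himg : π = (fun t => (Φ t : Plane)) '' Ioo a b := by
    rw [← h]
    ext x
    refine ⟨fun hx => ⟨Φ.symm ⟨x, hπ hx⟩, by simpa using hx, by simp⟩, ?_⟩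
    rintro ⟨t, ht, rfl⟩
    exact ht
  rw [himg, ← closure_Ioo hab.ne]
  refine (image_closure_of_isCompact ?_ hcont.continuousOn).symm
  rw [closure_Ioo hab.ne]
  exact isCompact_Icc

theorem IsPortion.closure_eq {γ π : Set Plane} (hγ : IsTopLine γ) (hπ : IsPortion γ π) :
    closure π = ∅ ∨
      ∃ (Φ : ℝ ≃ₜ γ) (a b : ℝ), closure π = (fun t => (Φ t : Plane)) '' Icc a b := by
  obtain ⟨Φ⟩ := hγ
  obtain ⟨a, b, h⟩ := hπ.2 Φ
  rcases lt_or_ge a b with hab | hab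
  · exact Or.inr ⟨Φ, a, b, closure_portion hπ.1 Φ h hab⟩
  · refine Or.inl (closure_empty_iff _ |>.2 (eq_empty_of_forall_notMem fun x hx => ?_))
    have hmem : Φ.symm ⟨x, hπ.1 hx⟩ ∈ {t : ℝ | (Φ t : Plane) ∈ π} := by simpa using hx
    rw [h, Ioo_eq_empty hab.not_gt] at hmem
    exact hmem

theorem IsPortion.closure_subset {γ π : Set Plane} (hγ : IsTopLine γ) (hπ : IsPortion γ π) :
    closure π ⊆ γ := by
  rcases hπ.closure_eq hγ with h | ⟨Φ, a, b, h⟩ <;> rw [h]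
  · exact empty_subset γ
  · rintro _ ⟨t, -, rfl⟩
    exact (Φ t).2

theorem IsPortion.hasLogOn_closure {γ π : Set Plane} (hγ : IsTopLine γ) (hπ : IsPortion γ π)
    {f : Plane → ℂ} (hf : Continuous f) (h0 : ∀ x ∈ closure π, f x ≠ 0) :
    HasLogOn f (closure π) := by
  rcases hπ.closure_eq hγ with h | ⟨Φ, a, b, h⟩ <;> rw [h] at h0 ⊢
  · simp [HasLogOn]
  · exact hasLogOn_arc Φ hf fun t ht => h0 _ ⟨t, ht, rfl⟩

/-- Every point of `γ \ γ'` is adherent to each bounded component of the complement of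
`lineJ γ γ'`. -/
theorem sdiff_subset_closure_component {γ γ' : Set Plane} (hγ : IsTopLine γ)
    (hγ' : IsTopLine γ') (hπ : IsPortion γ (γ \ γ')) (hπ' : IsPortion γ' (γ' \ γ)) {q : Plane}
    (hq : q ∈ intRegion (lineJ γ γ')) :
    γ \ γ' ⊆ closure (connectedComponentIn (lineJ γ γ')ᶜ q) := by
  intro p hp
  by_contra hpU
  obtain ⟨hqJ, hqb⟩ := hq
  have hJ : IsClosed (lineJ γ γ') := isClosed_closure
  have hJeq : lineJ γ γ' = closure (γ \ γ') ∪ closure (γ' \ γ) := by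
    rw [lineJ, Set.symmDiff_def, closure_union]
  have hfr := frontier_connectedComponentIn_subset hJ q
  have hqU := mem_connectedComponentIn (F := (lineJ γ γ')ᶜ) hqJ
  generalize connectedComponentIn (lineJ γ γ')ᶜ q = U at *
  have hne : ∀ x ∈ lineJ γ γ', displacement q x ≠ 0 := fun x hx =>
    displacement_ne_zero fun h => hqJ (h ▸ hx)
  obtain ⟨Φ⟩ := hγ
  obtain ⟨a, b, h⟩ := hπ.2 Φ
  have hcont : Continuous fun t => (Φ t : Plane) := by fun_prop
  obtain ⟨t, rfl⟩ : ∃ t, (Φ t : Plane) = p := ⟨Φ.symm ⟨p, hp.1⟩, by simp⟩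
  have ht : t ∈ Ioo a b := h ▸ hp
  have hcl := closure_portion hπ.1 Φ h (ht.1.trans ht.2)
  have hnhds : (fun t => (Φ t : Plane)) ⁻¹' (closure U)ᶜ ∈ 𝓝 t :=
    (isClosed_closure.isOpen_compl.preimage hcont).mem_nhds hpU
  obtain ⟨c, d, ⟨hct, htd⟩, hcd⟩ := mem_nhds_iff_exists_Ioo_subset.1 hnhds
  have harc : ∀ u v, a ≤ u → v ≤ b →
      HasLogOn (displacement q) ((fun t => (Φ t : Plane)) '' Icc u v) ∧
      IsClosed ((fun t => (Φ t : Plane)) '' Icc u v) := fun u v hu hv => by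
    refine ⟨hasLogOn_arc Φ (continuous_displacement q) fun s hs => hne _ ?_,
      (isCompact_Icc.image hcont).isClosed⟩
    rw [hJeq, hcl]
    exact Or.inl ⟨s, ⟨hu.trans hs.1, hs.2.trans hv⟩, rfl⟩
  obtain ⟨hlog₁, hclosed₁⟩ := harc a c le_rfl (hct.le.trans ht.2.le)
  obtain ⟨hlog₂, hclosed₂⟩ := harc d b (ht.1.le.trans htd.le) le_rfl
  have hlog' : HasLogOn (displacement q) (closure (γ' \ γ)) :=
    hπ'.hasLogOn_closure hγ' (continuous_displacement q) fun x hx =>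
      hne x (hJeq ▸ Or.inr hx)
  -- A point of the open arc `γ \ γ'` is not adherent to `γ' \ γ`, which lies in the line `γ'`.
  have hmeet : ∀ s, (Φ s : Plane) ∈ closure (γ' \ γ) → s ∉ Ioo a b := fun s hs hsab => by
    rw [← h] at hsab
    exact hsab.2 (hπ'.closure_subset hγ' hs)
  have hlog₁' := hlog'.union hlog₁ isClosed_closure hclosed₁ (p := (Φ a : Plane)) (by
    rintro _ ⟨hx, s, hs, rfl⟩
    have := hmeet s hx
    have hsa : s = a := le_antisymm
      (not_lt.1 fun hlt => this ⟨hlt, hs.2.trans_lt (hct.trans ht.2)⟩) hs.1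
    simp [hsa])
  have hlog := hlog₁'.union hlog₂ (isClosed_closure.union hclosed₁) hclosed₂
    (p := (Φ b : Plane)) (by
    rintro _ ⟨hx | ⟨r, hr, hrs⟩, s, hs, rfl⟩
    · have := hmeet s hx
      have hsb : s = b := le_antisymm hs.2
        (not_lt.1 fun hlt => this ⟨(ht.1.trans htd).trans_le hs.1, hlt⟩)
      simp [hsb]
    · have hrs' : r = s := Φ.injective (Subtype.ext hrs)
      linarith [hr.2, hs.1])
  refine not_hasLogOn_frontier hqb hqU ?_
  obtain ⟨g, hg, hgf⟩ := hlog
  suffices hsub : frontier U ⊆ closure (γ' \ γ) ∪ (fun t => (Φ t : Plane)) '' Icc a c ∪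
      (fun t => (Φ t : Plane)) '' Icc d b from
    ⟨g, hg.mono hsub, fun x hx => hgf x (hsub hx)⟩
  intro x hx
  have hxJ := hfr hx
  rw [hJeq, hcl] at hxJ
  rcases hxJ with ⟨s, hs, rfl⟩ | hxJ
  · rcases le_or_gt s c with hsc | hcs
    · exact Or.inl (Or.inr ⟨s, ⟨hs.1, hsc⟩, rfl⟩)
    rcases le_or_gt d s with hds | hsd
    · exact Or.inr ⟨s, ⟨hds, hs.2⟩, rfl⟩
    exact absurd hx.1 (hcd ⟨hcs, hsd⟩)
  · exact Or.inl (Or.inl hxJ)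

theorem lineJ_subset_closure_intRegion {γ γ' : Set Plane} (hγ : IsTopLine γ)
    (hγ' : IsTopLine γ') (hπ : IsPortion γ (γ \ γ')) (hπ' : IsPortion γ' (γ' \ γ))
    (hne : (intRegion (lineJ γ γ')).Nonempty) :
    lineJ γ γ' ⊆ closure (intRegion (lineJ γ γ')) := by
  obtain ⟨q, hq⟩ := hne
  have hU : connectedComponentIn (lineJ γ γ')ᶜ q ⊆ intRegion (lineJ γ γ') := fun z hz =>
    ⟨connectedComponentIn_subset _ _ hz, connectedComponentIn_eq hz ▸ hq.2⟩
  refine (closure_minimal ?_ isClosed_closure).trans (closure_mono hU)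
  rintro x (hx | hx)
  · exact sdiff_subset_closure_component hγ hγ' hπ hπ' hq hx
  · rw [lineJ_comm] at hq ⊢
    exact sdiff_subset_closure_component hγ' hγ hπ' hπ hq hx

theorem Between.symm {γ γ' σ : Set Plane} (hγ : IsTopLine γ) (hγ' : IsTopLine γ')
    (hπ : IsPortion γ (γ \ γ')) (hπ' : IsPortion γ' (γ' \ γ)) (hσ : γ ≠ σ)
    (h : Between γ γ' σ) : Between γ' γ σ := by
  have hne : (intRegion (lineJ γ γ')).Nonempty := by
    rw [← closure_nonempty_iff]
    refine Set.Nonempty.mono h (Set.Nonempty.closure ?_)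
    rw [Set.nonempty_iff_ne_empty]
    exact fun hempty => hσ (symmDiff_eq_bot.1 hempty)
  have hJ := lineJ_subset_closure_intRegion hγ hγ' hπ hπ' hne
  rw [Between, lineJ_comm γ' γ]
  refine closure_minimal ?_ isClosed_closure
  intro x hx
  rcases symmDiff_triangle γ' γ σ hx with hx | hx
  · exact hJ (subset_closure (symmDiff_comm γ' γ ▸ hx))
  · exact h (subset_closure hx)

theorem stmt10 (Γ : Set (Set Plane)) (hline : ∀ γ ∈ Γ, IsTopLine γ)
    (hport : ∀ γ ∈ Γ, ∀ γ' ∈ Γ, γ ≠ γ' → IsPortion γ (γ \ γ'))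
    (γ γ' σ : Set Plane) (hγ : γ ∈ Γ) (hγ' : γ' ∈ Γ) (hσ : σ ∈ Γ)
    (h1 : γ ≠ γ') (h2 : γ ≠ σ) (h3 : γ' ≠ σ) :
    Between γ γ' σ ↔ Between γ' γ σ :=
  have hπ := hport γ hγ γ' hγ' h1
  have hπ' := hport γ' hγ' γ hγ h1.symm
  ⟨Between.symm (hline γ hγ) (hline γ' hγ') hπ hπ' h2,
    Between.symm (hline γ' hγ') (hline γ hγ) hπ' hπ h3⟩
end
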